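/- arXiv:1905.07169 — 2 statements merged into one kernel-verified Lean document; each statement's English description precedes it below -/
import Mathlib

section
/- Let J be a finite set of jobs with execution times w : J → ℝ satisfying w(j) ≥ 0 for all j, let Ψ = Σ_{j ∈ J} w(j), let m ≥ 1, and let τ ≥ 0 be such that every individual job satisfies w(j) ≤ τ·Ψ. Then there exists an assignment f : J → Fin m whose makespan max_{i < m} Σ_{j : f(j) = i} w(j) is at most Ψ·((1 − τ)/m + τ). -/
/-- List scheduling: adding the jobs one at a time to a least loaded core keeps every load below
the average load plus `(1 - 1/m)` times a bound on the individual weights. -/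
theorem exists_assignment_forall_load_le {J ι R : Type*} [Fintype ι] [Nonempty ι] [DecidableEq ι]
    [Field R] [LinearOrder R] [IsStrictOrderedRing R]
    (w : J → R) (B : R) (hB : 0 ≤ B) (s : Finset J) (hw : ∀ j ∈ s, 0 ≤ w j)
    (hwB : ∀ j ∈ s, w j ≤ B) :
    ∃ f : J → ι, ∀ i, ∑ j ∈ s with f j = i, w j ≤
      (∑ j ∈ s, w j) / Fintype.card ι + B * (1 - 1 / Fintype.card ι) := by
  classical
  have hcard : (1 : R) ≤ Fintype.card ι := by exact_mod_cast Fintype.card_pos (α := ι)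
  have hcoef : (0 : R) ≤ 1 - 1 / Fintype.card ι :=
    sub_nonneg.2 ((div_le_one (by linarith)).2 hcard)
  induction s using Finset.induction_on with
  | empty => exact ⟨fun _ => Classical.arbitrary ι, fun i => by simpa using mul_nonneg hB hcoef⟩
  | insert a s ha ih =>
    obtain ⟨f, hf⟩ := ih (fun j hj => hw j (Finset.mem_insert_of_mem hj))
      (fun j hj => hwB j (Finset.mem_insert_of_mem hj))
    have hwa := hw a (Finset.mem_insert_self a s)
    have hwaB := hwB a (Finset.mem_insert_self a s)
    obtain ⟨k, -, hk⟩ := Finset.exists_min_image Finset.univ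
      (fun i => ∑ j ∈ s with f j = i, w j) Finset.univ_nonempty
    have hmin : ∑ j ∈ s with f j = k, w j ≤ (∑ j ∈ s, w j) / Fintype.card ι := by
      rw [le_div_iff₀ (by linarith), mul_comm, ← nsmul_eq_mul, ← Finset.card_univ,
        ← Finset.sum_fiberwise s f w]
      exact Finset.card_nsmul_le_sum _ _ _ hk
    have hload (i : ι) : ∑ j ∈ s with Function.update f a k j = i, w j =
        ∑ j ∈ s with f j = i, w j := by
      congr 1
      refine Finset.filter_congr fun j hj => ?_
      rw [Function.update_of_ne (ne_of_mem_of_not_mem hj ha)]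
    refine ⟨Function.update f a k, fun i => ?_⟩
    rw [Finset.filter_insert, Function.update_self, Finset.sum_insert ha, add_div]
    split_ifs with hki
    · subst hki
      rw [Finset.sum_insert (by simp [ha]), hload]
      have := mul_le_mul_of_nonneg_right hwaB hcoef
      rw [mul_sub, mul_one, mul_one_div] at this
      linarith
    · rw [hload]
      have : 0 ≤ w a / Fintype.card ι := div_nonneg hwa (by linarith)
      linarith [hf i]

/-- Upper bound: if each job weight is at most `τ · Ψ`, there is an assignment
to `m` cores whose makespan is at most `Ψ · ((1 - τ)/m + τ)`. -/
theorem makespan_upper_bound {J : Type*} [Fintype J] (w : J → ℝ)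
    (hw : ∀ j, 0 ≤ w j) (m : ℕ) (hm : 1 ≤ m) (τ : ℝ) (hτ : 0 ≤ τ)
    (hjob : ∀ j, w j ≤ τ * ∑ j', w j') :
    ∃ f : J → Fin m,
      Finset.univ.sup' ⟨⟨0, by omega⟩, Finset.mem_univ _⟩
        (fun i : Fin m => ∑ j ∈ Finset.univ.filter (fun j => f j = i), w j) ≤
      (∑ j, w j) * ((1 - τ) / m + τ) := by
  have : NeZero m := ⟨by omega⟩
  obtain ⟨f, hf⟩ := exists_assignment_forall_load_le (ι := Fin m) w (τ * ∑ j, w j)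
    (mul_nonneg hτ (Finset.sum_nonneg fun j _ => hw j)) Finset.univ (fun j _ => hw j)
    (fun j _ => hjob j)
  refine ⟨f, Finset.sup'_le _ _ fun i _ => (hf i).trans_eq ?_⟩
  rw [Fintype.card_fin]
  ring
end

section
/- Let r : V → V → Prop be a directed graph and B' ⊆ V a set of vertices. For a vertex v, let S(v) = {w | Relation.ReflTransGen r v w ∧ Relation.ReflTransGen r w v} be its strongly connected component under r. Suppose that for every vertex v ∉ B' there is no cycle through v inside its own SCC after removing B', i.e., ¬ Relation.TransGen (fun a b => r a b ∧ a ∈ S(v) ∧ a ∉ B' ∧ b ∈ S(v) ∧ b ∉ B') v v. Then the graph obtained by deleting B' is acyclic: for every v ∉ B', ¬ Relation.TransGen (fun a b => r a b ∧ a ∉ B' ∧ b ∉ B') v v. -/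
/-- Every edge of a walk from `a` to `b` starts at a vertex reachable from `a` and, if `c` is
reachable from `b`, ends at a vertex from which `c` is reachable. -/
theorem Relation.TransGen.edges_between {V : Type*} {s : V → V → Prop} {a b c : V}
    (hab : Relation.TransGen s a b) (hbc : Relation.ReflTransGen s b c) :
    Relation.TransGen
      (fun x y => s x y ∧ Relation.ReflTransGen s a x ∧ Relation.ReflTransGen s y c) a b := by
  induction hab with
  | single e => exact .single ⟨e, .refl, hbc⟩
  | tail p e ih => exact (ih (hbc.head e)).tail ⟨e, p.to_reflTransGen, hbc⟩

/-- If deleting `B'` breaks all cycles within each strongly connected component,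
then deleting `B'` makes the whole graph acyclic. -/
theorem acyclic_of_scc_cycles_broken {V : Type*} (r : V → V → Prop) (B' : Set V)
    (h : ∀ v ∉ B',
      ¬ Relation.TransGen
          (fun a b => r a b ∧
            a ∈ {w | Relation.ReflTransGen r v w ∧ Relation.ReflTransGen r w v} ∧
            a ∉ B' ∧
            b ∈ {w | Relation.ReflTransGen r v w ∧ Relation.ReflTransGen r w v} ∧
            b ∉ B')
          v v) :
    ∀ v ∉ B', ¬ Relation.TransGen (fun a b => r a b ∧ a ∉ B' ∧ b ∉ B') v v := by
  intro v hv cycle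
  have forget : ∀ {x y}, Relation.ReflTransGen (fun a b => r a b ∧ a ∉ B' ∧ b ∉ B') x y →
      Relation.ReflTransGen r x y := fun p => Relation.ReflTransGen.mono (fun _ _ e => e.1) _ _ p
  refine h v hv (Relation.TransGen.mono ?_ _ _ (cycle.edges_between .refl))
  rintro a b ⟨⟨hab, ha, hb⟩, hva, hbv⟩
  exact ⟨hab, ⟨forget hva, (forget hbv).head hab⟩, ha, ⟨(forget hva).tail hab, forget hbv⟩, hb⟩
end
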